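/- arXiv:2302.12909 — 6 statements merged into one kernel-verified Lean document; each statement's English description precedes it below -/
import Mathlib

section
/- Let n, d, K be positive integers with K ≤ min(n, d), let B, L > 0, and set Δ := B/√K. Let 𝔅 := { w ∈ ℝ^d : ‖w‖ ≤ B }, and for each sign vector σ ∈ {−1,1}^K define the linear empirical loss F_σ(w) := (L/n)·Σ_{j=1}^K σ_j·w_j. Then for every map A : {−1,1}^K → 𝔅 satisfying ‖A(σ) − A(σ′)‖ ≤ Δ whenever σ and σ′ differ in exactly one coordinate, the average excess empirical risk over the packing is bounded below: 2^{−K} Σ_{σ ∈ {−1,1}^K} ( F_σ(A(σ)) − min_{w∈𝔅} F_σ(w) ) ≥ B·L·√K/(2n). In particular there exists σ with F_σ(A(σ)) − min_{w∈𝔅} F_σ(w) ≥ B·L·√K/(2n). -/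
/-- packing lower bound. For `K ≤ min(n,d)`, `Δ = B/√K`, and any map
`A` from sign vectors `{−1,1}^K` into the ball `𝔅 = {‖w‖ ≤ B}` which is `Δ`-stable
under single-coordinate changes of the sign vector, the average (over the `2^K` sign
vectors) excess empirical risk of the linear losses
`F_σ(w) = (L/n)·Σ_j σ_j w_j` is at least `B·L·√K/(2n)`; in particular some `σ`
attains this bound. -/
theorem packing_average_risk_lower_bound {n d K : ℕ}
    (hn : 0 < n) (hd : 0 < d) (hK : 0 < K) (hKnd : K ≤ min n d)
    (B L : ℝ) (hB : 0 < B) (hL : 0 < L)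
    (A : (Fin K → ℝ) → EuclideanSpace ℝ (Fin d))
    (hAmem : ∀ σ : Fin K → ℝ, (∀ j, σ j = 1 ∨ σ j = -1) → ‖A σ‖ ≤ B)
    (hstab : ∀ σ σ' : Fin K → ℝ, (∀ j, σ j = 1 ∨ σ j = -1) →
      (∀ j, σ' j = 1 ∨ σ' j = -1) → ∀ i : Fin K, (∀ j, j ≠ i → σ j = σ' j) →
      ‖A σ - A σ'‖ ≤ B / Real.sqrt K) :
    (let Fℓ : (Fin K → ℝ) → EuclideanSpace ℝ (Fin d) → ℝ := fun σ w =>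
       (L / n) * ∑ j : Fin K, σ j * w (Fin.castLE (hKnd.trans (min_le_right n d)) j)
     let 𝔅 : Set (EuclideanSpace ℝ (Fin d)) := {w | ‖w‖ ≤ B}
     let U : Finset (Fin K → ℝ) := Fintype.piFinset fun _ => ({-1, 1} : Finset ℝ)
     ((2 : ℝ) ^ K)⁻¹ * ∑ σ ∈ U, (Fℓ σ (A σ) - sInf (Fℓ σ '' 𝔅))
        ≥ B * L * Real.sqrt K / (2 * n)
     ∧ ∃ σ ∈ U, Fℓ σ (A σ) - sInf (Fℓ σ '' 𝔅) ≥ B * L * Real.sqrt K / (2 * n)) := by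
  intro Fℓ 𝔅 U
  have hU : ∀ σ, σ ∈ U ↔ ∀ j, σ j = 1 ∨ σ j = -1 := by
    intro σ
    simp only [U, Fintype.mem_piFinset, Finset.mem_insert, Finset.mem_singleton]
    exact forall_congr' fun j => or_comm
  have hcard : (U.card : ℝ) = 2 ^ K := by
    have : ({-1, 1} : Finset ℝ).card = 2 := by
      rw [Finset.card_pair]; norm_num
    simp [U, Fintype.card_piFinset, this]
  have hKr : (0 : ℝ) < K := by exact_mod_cast hK
  have hnr : (0 : ℝ) < n := by exact_mod_cast hn
  have hs : 0 < Real.sqrt K := Real.sqrt_pos.2 hKr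
  have hss : Real.sqrt K * Real.sqrt K = K := Real.mul_self_sqrt hKr.le
  set c : Fin K → Fin d := fun j => Fin.castLE (hKnd.trans (min_le_right n d)) j with hc
  have hcoord : ∀ (w : EuclideanSpace ℝ (Fin d)) i, |w i| ≤ ‖w‖ := fun w i => by
    simpa using PiLp.norm_apply_le w i
  have hF : ∀ σ w, Fℓ σ w = (L / n) * ∑ j : Fin K, σ j * w (c j) := fun _ _ => rfl
  -- the infimum
  have hinf : ∀ σ ∈ U, sInf (Fℓ σ '' 𝔅) ≤ -(B * L * Real.sqrt K / n) := by
    intro σ hσ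
    rw [hU] at hσ
    apply csInf_le
    · refine ⟨(L / n) * ∑ j : Fin K, (-B), ?_⟩
      rintro _ ⟨w, hw, rfl⟩
      rw [hF]
      apply mul_le_mul_of_nonneg_left _ (by positivity)
      apply Finset.sum_le_sum
      intro j _
      have h1 := abs_le.1 ((hcoord w (c j)).trans hw)
      rcases hσ j with h | h <;> rw [h] <;> linarith [h1.1, h1.2]
    · let w : EuclideanSpace ℝ (Fin d) := WithLp.toLp 2
        (fun i => if h : (i : ℕ) < K then -(B / Real.sqrt K) * σ ⟨i, h⟩ else 0)
      refine ⟨w, ?_, ?_⟩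
      · change ‖w‖ ≤ B
        rw [EuclideanSpace.norm_eq]
        apply Real.sqrt_le_iff.2 ⟨hB.le, ?_⟩
        have h1 : ∀ i : Fin d, ‖w i‖ ^ 2 = if (i : ℕ) < K then B ^ 2 / K else 0 := by
          intro i
          simp only [w]
          split_ifs with h
          · rw [Real.norm_eq_abs, sq_abs]
            have : σ ⟨i, h⟩ ^ 2 = 1 := by rcases hσ ⟨i, h⟩ with h | h <;> rw [h] <;> norm_num
            rw [mul_pow, this, neg_sq, div_pow, Real.sq_sqrt hKr.le, mul_one]
          · simp
        rw [Finset.sum_congr rfl fun i _ => h1 i, ← Finset.sum_filter, Finset.sum_const,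
          nsmul_eq_mul]
        have h2 : (Finset.univ.filter fun i : Fin d => (i : ℕ) < K).card ≤ K := by
          rw [Fin.card_filter_val_lt]; exact min_le_right _ _
        have h3 : ((Finset.univ.filter fun i : Fin d => (i : ℕ) < K).card : ℝ) ≤ K := by
          exact_mod_cast h2
        calc _ ≤ (K : ℝ) * (B ^ 2 / K) := by gcongr
          _ = B ^ 2 := by field_simp
      · rw [hF]
        have h1 : ∀ j, σ j * w (c j) = -(B / Real.sqrt K) := by
          intro j
          have : w (c j) = -(B / Real.sqrt K) * σ j := by simp [w, c]
          rw [this]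
          rcases hσ j with h | h <;> rw [h] <;> ring
        rw [Finset.sum_congr rfl fun j _ => h1 j]
        simp only [Finset.sum_const, Finset.card_univ, Fintype.card_fin, nsmul_eq_mul]
        field_simp
        linear_combination hss
  -- pairing
  have hpair : ∀ j : Fin K, -(2 ^ K * (B / Real.sqrt K) / 2) ≤ ∑ σ ∈ U, σ j * A σ (c j) := by
    intro j
    let f : (Fin K → ℝ) → (Fin K → ℝ) := fun σ => Function.update σ j (-σ j)
    have hfU : ∀ σ ∈ U, f σ ∈ U := by
      intro σ hσ
      rw [hU] at hσ ⊢
      intro i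
      by_cases h : i = j
      · subst h
        rcases hσ i with h | h <;> simp [f, h]
      · simpa [f, h] using hσ i
    have hff : ∀ σ, f (f σ) = σ := by intro σ; simp [f]
    have h1 : ∑ σ ∈ U, σ j * A σ (c j) = ∑ σ ∈ U, (f σ) j * A (f σ) (c j) :=
      Finset.sum_nbij' f f hfU hfU (fun σ _ => hff σ) (fun σ _ => hff σ)
        (fun σ _ => by rw [hff])
    have h2 : ∑ σ ∈ U, -(B / Real.sqrt K) ≤
        ∑ σ ∈ U, (σ j * A σ (c j) + (f σ) j * A (f σ) (c j)) := by
      apply Finset.sum_le_sum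
      intro σ hσ
      have h3 := hstab σ (f σ) ((hU σ).1 hσ) ((hU _).1 (hfU σ hσ)) j
        (fun i hi => by simp [f, hi])
      have h4 := abs_le.1 ((hcoord _ (c j)).trans h3)
      have h5 : f σ j = - σ j := by simp [f]
      rw [PiLp.sub_apply] at h4
      rw [h5]
      rcases (hU σ).1 hσ j with h | h <;> rw [h] <;> linarith [h4.1, h4.2]
    rw [Finset.sum_add_distrib, ← h1, Finset.sum_const, nsmul_eq_mul, hcard] at h2
    linarith
  have hsum : 2 ^ K * (B * L * Real.sqrt K / (2 * n)) ≤
      ∑ σ ∈ U, (Fℓ σ (A σ) - sInf (Fℓ σ '' 𝔅)) := by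
    have h1 : ∑ σ ∈ U, Fℓ σ (A σ) = (L / n) * ∑ j, ∑ σ ∈ U, σ j * A σ (c j) := by
      rw [Finset.sum_comm, Finset.mul_sum]
    have h2 : ∑ j : Fin K, -(2 ^ K * (B / Real.sqrt K) / 2) ≤
        ∑ j, ∑ σ ∈ U, σ j * A σ (c j) := Finset.sum_le_sum fun j _ => hpair j
    have h3 := mul_le_mul_of_nonneg_left h2 (by positivity : 0 ≤ L / n)
    rw [← h1] at h3
    have h4 := Finset.sum_le_sum hinf
    rw [Finset.sum_const, nsmul_eq_mul, hcard] at h4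
    rw [Finset.sum_const, nsmul_eq_mul, Finset.card_univ, Fintype.card_fin] at h3
    rw [Finset.sum_sub_distrib]
    have h5 : L / n * (K * -(2 ^ K * (B / Real.sqrt K) / 2)) =
        - (2 ^ K * (B * L * Real.sqrt K / (2 * n))) := by
      field_simp
      linear_combination hss
    have h6 : (2 : ℝ) ^ K * -(B * L * Real.sqrt K / n) =
        - (2 * (2 ^ K * (B * L * Real.sqrt K / (2 * n)))) := by
      field_simp
    linarith
  refine ⟨?_, ?_⟩
  · rw [ge_iff_le, le_inv_mul_iff₀ (by positivity)]
    exact hsum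
  · apply Finset.exists_le_of_sum_le
    · exact ⟨fun _ => 1, (hU _).2 fun _ => Or.inl rfl⟩
    · rw [Finset.sum_const, nsmul_eq_mul, hcard]
      exact hsum
end

section
/- Let n, d be positive integers, B, L > 0, and Δ satisfy B/√(min(n,d)) ≤ Δ ≤ B. Let 𝔅 := { w ∈ ℝ^d : ‖w‖ ≤ B } and f(w; x) := ⟨w, x⟩. Then for every measurable deterministic algorithm A : (ℝ^d)^n → 𝔅 which is Δ-uniformly argument stable, i.e. ‖A(S) − A(S′)‖ ≤ Δ whenever the tuples S, S′ ∈ (ℝ^d)^n differ in exactly one coordinate, there exists a dataset S = (x₁, …, x_n) with ‖x_i‖ ≤ L for every i such that the excess empirical risk satisfies F_S(A(S)) − min_{w∈𝔅} F_S(w) ≥ B²L/(5Δn), where F_S(w) := (1/n)Σ_{i=1}^n ⟨w, x_i⟩. In particular, every Δ-uniformly argument stable algorithm has worst-case excess empirical risk Ω(B²L/(Δn)) on 0-smooth L-Lipschitz convex losses. -/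
lemma aux_flip {n d : ℕ} (k : ℕ) (hk : k ≤ n) (L Δ : ℝ) (hL : 0 < L) (hΔ : 0 < Δ)
    (A : (Fin n → EuclideanSpace ℝ (Fin d)) → EuclideanSpace ℝ (Fin d))
    (hstab : ∀ S S' : Fin n → EuclideanSpace ℝ (Fin d), ∀ i : Fin n,
      (∀ j, j ≠ i → S j = S' j) → ‖A S - A S'‖ ≤ Δ)
    (v : Fin n → EuclideanSpace ℝ (Fin d))
    (hv : ∀ i, ‖v i‖ = if (i : ℕ) < k then 1 else 0) :
    ∃ σ : Fin n → Bool,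
      -(k * L * Δ / 2) ≤ ∑ i, (inner ℝ (A (fun i => (if σ i then L else -L) • v i))
        ((if σ i then L else -L) • v i) : ℝ) := by
  set S : (Fin n → Bool) → Fin n → EuclideanSpace ℝ (Fin d) :=
    fun σ i => (if σ i then L else -L) • v i with hS
  have key : ∀ i : Fin n, ∑ σ : Fin n → Bool, (-(if (i : ℕ) < k then L * Δ / 2 else 0) : ℝ)
      ≤ ∑ σ : Fin n → Bool, (inner ℝ (A (S σ)) (S σ i) : ℝ) := by
    intro i
    let e : (Fin n → Bool) → (Fin n → Bool) := fun σ => Function.update σ i (!σ i)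
    have he : Function.Involutive e := by
      intro σ
      simp [e]
    have h1 : ∑ σ : Fin n → Bool, (inner ℝ (A (S (e σ))) (S (e σ) i) : ℝ)
        = ∑ σ : Fin n → Bool, (inner ℝ (A (S σ)) (S σ i) : ℝ) :=
      Equiv.sum_comp (he.toPerm) (fun σ => (inner ℝ (A (S σ)) (S σ i) : ℝ))
    have h2 : ∀ σ : Fin n → Bool, 2 * (-(if (i : ℕ) < k then L * Δ / 2 else 0) : ℝ) ≤
        (inner ℝ (A (S σ)) (S σ i) : ℝ) + (inner ℝ (A (S (e σ))) (S (e σ) i) : ℝ) := by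
      intro σ
      have h3 : S (e σ) i = - S σ i := by
        simp only [hS, e, Function.update_self]
        cases σ i <;> simp
      rw [h3, inner_neg_right, ← sub_eq_add_neg, ← inner_sub_left]
      have h4 : ‖A (S σ) - A (S (e σ))‖ ≤ Δ := by
        apply hstab _ _ i
        intro j hj
        simp [hS, e, hj]
      have h5 : ‖S σ i‖ = if (i : ℕ) < k then L else 0 := by
        simp only [hS, norm_smul, hv]
        cases σ i <;> simp [abs_of_pos hL]
      have h6 := neg_le_of_abs_le (abs_real_inner_le_norm (A (S σ) - A (S (e σ))) (S σ i))
      have h7 : ‖A (S σ) - A (S (e σ))‖ * ‖S σ i‖ ≤ Δ * ‖S σ i‖ := by gcongr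
      rw [h5] at h6 h7
      split_ifs at * <;> linarith
    have h8 := Finset.sum_le_sum (fun σ (_ : σ ∈ Finset.univ) => h2 σ)
    rw [Finset.sum_add_distrib, h1, ← Finset.mul_sum] at h8
    linarith
  have tot := Finset.sum_le_sum (fun i (_ : i ∈ Finset.univ) => key i)
  rw [Finset.sum_comm, Finset.sum_comm (s := (Finset.univ : Finset (Fin n)))] at tot
  obtain ⟨σ, -, hσ⟩ := Finset.exists_le_of_sum_le Finset.univ_nonempty tot
  refine ⟨σ, le_trans (le_of_eq ?_) hσ⟩
  rw [Finset.sum_neg_distrib, Fin.sum_univ_eq_sum_range (fun i => if i < k then L * Δ / 2 else 0),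
    ← Finset.sum_filter]
  have : (Finset.range n).filter (· < k) = Finset.range k := by
    ext a; simp; omega
  rw [this]; simp; ring

lemma aux_norm {n d : ℕ} (k : ℕ) (hk : k ≤ n) (L : ℝ)
    (v : Fin n → EuclideanSpace ℝ (Fin d))
    (hv : ∀ i, ‖v i‖ = if (i : ℕ) < k then 1 else 0)
    (ho : ∀ i j, i ≠ j → (inner ℝ (v i) (v j) : ℝ) = 0) (σ : Fin n → Bool) :
    ‖∑ i, (if σ i then L else -L) • v i‖ ^ 2 = L ^ 2 * k := by
  rw [← real_inner_self_eq_norm_sq, sum_inner]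
  have : ∀ i : Fin n, (inner ℝ ((if σ i then L else -L) • v i)
      (∑ i, (if σ i then L else -L) • v i) : ℝ) = if (i : ℕ) < k then L ^ 2 else 0 := by
    intro i
    rw [inner_sum, Finset.sum_eq_single i]
    · rw [real_inner_self_eq_norm_sq, norm_smul, mul_pow, hv]
      cases σ i <;> split_ifs <;> simp
    · intro j _ hj
      rw [inner_smul_left, inner_smul_right, ho i j hj.symm]; simp
    · simp
  rw [Finset.sum_congr rfl (fun i _ => this i),
    Fin.sum_univ_eq_sum_range (fun i => if i < k then L ^ 2 else 0), ← Finset.sum_filter]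
  have : (Finset.range n).filter (· < k) = Finset.range k := by
    ext a; simp; omega
  rw [this]; simp; ring

lemma aux_inf {n d : ℕ} (B : ℝ) (hB : 0 < B)
    (S : Fin n → EuclideanSpace ℝ (Fin d)) :
    sInf ((fun w => (n : ℝ)⁻¹ * ∑ i, (inner ℝ w (S i) : ℝ)) '' {w | ‖w‖ ≤ B})
      ≤ (n : ℝ)⁻¹ * -(B * ‖∑ i, S i‖) := by
  set s := ∑ i, S i with hs
  have hi : ∀ w, ∑ i, (inner ℝ w (S i) : ℝ) = inner ℝ w s := fun w => by rw [hs, inner_sum]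
  simp only [hi]
  apply csInf_le
  · refine ⟨(n : ℝ)⁻¹ * -(B * ‖s‖), ?_⟩
    rintro _ ⟨w, hw, rfl⟩
    have h6 := neg_le_of_abs_le (abs_real_inner_le_norm w s)
    have h7 : ‖w‖ * ‖s‖ ≤ B * ‖s‖ := by
      have : ‖w‖ ≤ B := hw
      gcongr
    apply mul_le_mul_of_nonneg_left _ (by positivity)
    linarith
  · rcases eq_or_ne s 0 with h | h
    · exact ⟨0, by simpa using hB.le, by simp [h]⟩
    · have hp : 0 < ‖s‖ := norm_pos_iff.mpr h
      refine ⟨(-(B / ‖s‖)) • s, ?_, ?_⟩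
      · simp only [Set.mem_ofPred_eq, norm_smul, norm_neg, norm_div, Real.norm_eq_abs, abs_norm,
          abs_of_pos hB]
        rw [div_mul_cancel₀ _ hp.ne']
      · simp only
        rw [real_inner_smul_left, real_inner_self_eq_norm_sq]
        field_simp


/-- tradeoff between stability and empirical accuracy. Every measurable
`Δ`-uniformly argument stable algorithm `A` mapping datasets of `n` points of `ℝ^d`
into the ball `𝔅 = {‖w‖ ≤ B}`, with `B/√(min(n,d)) ≤ Δ ≤ B`, admits a dataset
`S = (x₁,…,x_n)` with `‖xᵢ‖ ≤ L` on which the excess empirical risk of the linear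
loss `f(w;x) = ⟨w,x⟩` is at least `B²L/(5Δn)`. -/
theorem stability_accuracy_tradeoff {n d : ℕ} (hn : 0 < n) (hd : 0 < d)
    (B L Δ : ℝ) (hB : 0 < B) (hL : 0 < L)
    (hΔlow : B / Real.sqrt (min n d : ℕ) ≤ Δ) (hΔhigh : Δ ≤ B)
    (A : (Fin n → EuclideanSpace ℝ (Fin d)) → EuclideanSpace ℝ (Fin d))
    (hAmeas : Measurable A)
    (hAmem : ∀ S, ‖A S‖ ≤ B)
    (hstab : ∀ S S' : Fin n → EuclideanSpace ℝ (Fin d), ∀ i : Fin n,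
      (∀ j, j ≠ i → S j = S' j) → ‖A S - A S'‖ ≤ Δ) :
    ∃ S : Fin n → EuclideanSpace ℝ (Fin d), (∀ i, ‖S i‖ ≤ L) ∧
      (n : ℝ)⁻¹ * (∑ i, (inner ℝ (A S) (S i) : ℝ))
        - sInf ((fun w => (n : ℝ)⁻¹ * ∑ i, (inner ℝ w (S i) : ℝ)) '' {w | ‖w‖ ≤ B})
        ≥ B ^ 2 * L / (5 * Δ * n) := by
  have hm : 0 < min n d := lt_min hn hd
  have hΔ : 0 < Δ := lt_of_lt_of_le (by positivity) hΔlow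
  have hr1 : 1 ≤ B / Δ := by rw [le_div_iff₀ hΔ]; linarith
  have hr2 : (B / Δ) ^ 2 ≤ (min n d : ℕ) := by
    have h0 : (0 : ℝ) < Real.sqrt (min n d : ℕ) := Real.sqrt_pos.mpr (by exact_mod_cast hm)
    have h1 : B / Δ ≤ Real.sqrt (min n d : ℕ) := by
      rw [div_le_iff₀ h0] at hΔlow
      rw [div_le_iff₀ hΔ]; linarith
    calc (B / Δ) ^ 2 ≤ Real.sqrt (min n d : ℕ) ^ 2 := by gcongr
      _ = _ := Real.sq_sqrt (Nat.cast_nonneg _)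
  set r := B / Δ with hr
  obtain ⟨k, hk1, hk2, hk3⟩ : ∃ k : ℕ, (k : ℝ) ≤ r ^ 2 ∧ r ^ 2 < k + 1 ∧ 1 ≤ k :=
    ⟨⌊r ^ 2⌋₊, Nat.floor_le (by positivity), Nat.lt_floor_add_one _,
      Nat.le_floor (by push_cast; nlinarith)⟩
  have hkm : k ≤ min n d := by exact_mod_cast hk1.trans hr2
  have hkn : k ≤ n := hkm.trans (min_le_left _ _)
  have hkd : k ≤ d := hkm.trans (min_le_right _ _)
  let v : Fin n → EuclideanSpace ℝ (Fin d) := fun i =>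
    if h : (i : ℕ) < k then EuclideanSpace.single ⟨i, h.trans_le hkd⟩ 1 else 0
  have hv : ∀ i, ‖v i‖ = if (i : ℕ) < k then 1 else 0 := by
    intro i
    simp only [v]
    split_ifs <;> simp
  have ho : ∀ i j, i ≠ j → (inner ℝ (v i) (v j) : ℝ) = 0 := by
    intro i j hij
    simp only [v]
    split_ifs
    · have : (i : ℕ) ≠ j := fun h => hij (Fin.ext h)
      simp [EuclideanSpace.inner_single_left, this]
    all_goals simp
  obtain ⟨σ, hσ⟩ := aux_flip k hkn L Δ hL hΔ A hstab v hv
  refine ⟨fun i => (if σ i then L else -L) • v i, ?_, ?_⟩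
  · intro i
    simp only [norm_smul, hv]
    cases σ i <;> split_ifs <;> simp [abs_of_pos hL, hL.le]
  have hN := aux_norm k hkn L v hv ho σ
  have hI := aux_inf B hB (fun i => (if σ i then L else -L) • v i)
  set s := ‖∑ i, (if σ i then L else -L) • v i‖ with hs
  have hs0 : 0 ≤ s := norm_nonneg _
  have hBr : B = r * Δ := by rw [hr]; field_simp
  -- s = L t with t^2 = k
  obtain ⟨t, ht⟩ : ∃ t, s = L * t := ⟨s / L, by field_simp⟩
  have ht0 : 0 ≤ t := by
    rw [ht] at hs0
    exact nonneg_of_mul_nonneg_right hs0 hL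
  have htk : t ^ 2 = k := by
    rw [ht, mul_pow] at hN
    exact mul_left_cancel₀ (by positivity) hN
  have hk3' : (1 : ℝ) ≤ k := by exact_mod_cast hk3
  have htr : t ≤ r := by
    apply le_of_not_gt
    intro h
    nlinarith
  have hnum : r ^ 2 / 5 ≤ r * t - t ^ 2 / 2 := by
    have : r ≤ 2 * t := by
      apply le_of_not_gt
      intro h
      nlinarith
    nlinarith
  have hfin : B ^ 2 * L / (5 * Δ) ≤ B * s - k * L * Δ / 2 := by
    have e1 : B ^ 2 * L / (5 * Δ) = (L * Δ) * (r ^ 2 / 5) := by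
      rw [hBr]; field_simp
    have e2 : B * s - k * L * Δ / 2 = (L * Δ) * (r * t - t ^ 2 / 2) := by
      rw [hBr, ht, ← htk]; ring
    rw [e1, e2]
    gcongr
  have hn' : (0 : ℝ) < n := by exact_mod_cast hn
  have e3 : B ^ 2 * L / (5 * Δ * n) = (n : ℝ)⁻¹ * (B ^ 2 * L / (5 * Δ)) := by
    field_simp
  rw [ge_iff_le, e3]
  have h9 := mul_le_mul_of_nonneg_left (hfin.trans (by linarith :
    _ ≤ B * s + ∑ i, (inner ℝ (A (fun i => (if σ i then L else -L) • v i))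
        ((if σ i then L else -L) • v i) : ℝ))) (inv_pos.mpr hn').le
  rw [mul_add] at h9
  rw [mul_neg] at hI
  linarith
end

section
/- (Stochastic gradient descent ascent.) Let z₀ ∈ C be deterministic, η > 0, T a positive integer, (Ω, 𝔉, P) a probability space with filtration 𝔉₀ ⊆ 𝔉₁ ⊆ ⋯ ⊆ 𝔉_T, and ∇₁, …, ∇_T random vectors in ℝ^{d₁} × ℝ^{d₂} with ∇_t being 𝔉_t-measurable. Define random iterates z₁, …, z_{T−1} by requiring, for each t ≥ 1, that z_t ∈ C and ⟨(z_{t−1} − η∇_t) − z_t, z − z_t⟩ ≤ 0 for all z ∈ C (i.e. z_t is the Euclidean projection of z_{t−1} − η∇_t onto C). Assume for each t: E[∇_t | 𝔉_{t−1}] = G(z_{t−1}) almost surely, and E[‖∇_t − G(z_{t−1})‖²] ≤ τ². Write z_t = (w_t, θ_t) and let (w̄, θ̄) := (1/T)Σ_{t=0}^{T−1}(w_t, θ_t). Then for every (w, θ) ∈ C: E[F(w̄, θ) − F(w, θ̄)] ≤ ‖z₀ − (w,θ)‖²/(2ηT) + (η/2)(L² + τ²). -/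
open MeasureTheory
open scoped MeasureTheory

lemma aux_inner_int {E Ω : Type*} [NormedAddCommGroup E] [InnerProductSpace ℝ E]
    {m0 : MeasurableSpace Ω} {P : Measure Ω} {u v : Ω → E} (hu : MemLp u 2 P) (hv : MemLp v 2 P) :
    Integrable (fun ω => (inner ℝ (u ω) (v ω) : ℝ)) P := by
  have h1 := (memLp_two_iff_integrable_sq_norm hu.1).1 hu
  have h2 := (memLp_two_iff_integrable_sq_norm hv.1).1 hv
  refine (h1.add h2).mono' (hu.1.inner hv.1) (Filter.Eventually.of_forall fun ω => ?_)
  have := norm_inner_le_norm (𝕜 := ℝ) (u ω) (v ω)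
  simp only [Pi.add_apply]
  nlinarith [sq_nonneg (‖u ω‖ - ‖v ω‖), sq_nonneg (‖u ω‖ + ‖v ω‖)]

lemma aux_pull {E Ω : Type*} [NormedAddCommGroup E] [InnerProductSpace ℝ E] [CompleteSpace E]
    {m m0 : MeasurableSpace Ω} {P : Measure Ω} [IsProbabilityMeasure P] (hm : m ≤ m0)
    {u g Y : Ω → E} (hu : MemLp u 2 P) (hum : AEStronglyMeasurable[m] u P)
    (hg : MemLp g 2 P) (hY : P[g | m] =ᵐ[P] Y) :
    ∫ ω, (inner ℝ (u ω) (g ω) : ℝ) ∂P = ∫ ω, (inner ℝ (u ω) (Y ω) : ℝ) ∂P := by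
  have h : P[fun ω => (inner ℝ (u ω) (g ω) : ℝ) | m] =ᵐ[P]
      fun ω => (inner ℝ (u ω) (P[g | m] ω) : ℝ) :=
    condExp_bilin_of_aestronglyMeasurable_left (innerSL ℝ (E := E)) hum
      (aux_inner_int hu hg) (hg.integrable (by norm_num))
  rw [← integral_condExp hm]
  refine integral_congr_ae ?_
  filter_upwards [h, hY] with ω h1 h2
  rw [h1, h2]

/-- second moment of an unbiased estimate -/
lemma aux_var {E Ω : Type*} [NormedAddCommGroup E] [InnerProductSpace ℝ E] [CompleteSpace E]
    {m m0 : MeasurableSpace Ω} {P : Measure Ω} [IsProbabilityMeasure P] (hm : m ≤ m0)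
    {g Y : Ω → E} (hg : MemLp g 2 P) (hY : P[g | m] =ᵐ[P] Y) :
    MemLp Y 2 P ∧ Integrable (fun ω => ‖g ω‖ ^ 2) P ∧ Integrable (fun ω => ‖Y ω‖ ^ 2) P ∧
    Integrable (fun ω => ‖g ω - Y ω‖ ^ 2) P ∧
    ∫ ω, ‖g ω‖ ^ 2 ∂P = ∫ ω, ‖g ω - Y ω‖ ^ 2 ∂P + ∫ ω, ‖Y ω‖ ^ 2 ∂P := by
  have hYL : MemLp Y 2 P := (memLp_congr_ae hY).1 (hg.condExp (by norm_num))
  have hYm : AEStronglyMeasurable[m] Y P := 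
    stronglyMeasurable_condExp.aestronglyMeasurable.congr hY
  have h1 := (memLp_two_iff_integrable_sq_norm hg.1).1 hg
  have h2 := (memLp_two_iff_integrable_sq_norm hYL.1).1 hYL
  have h3 := (memLp_two_iff_integrable_sq_norm (hg.sub hYL).1).1 (hg.sub hYL)
  refine ⟨hYL, h1, h2, h3, ?_⟩
  have e := aux_pull hm hYL hYm hg hY
  have i1 := aux_inner_int hYL hg
  have i2 := aux_inner_int hYL hYL
  have key : ∀ ω, ‖g ω - Y ω‖ ^ 2 = ‖g ω‖ ^ 2 - 2 * inner ℝ (Y ω) (g ω) + ‖Y ω‖ ^ 2 := by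
    intro ω
    rw [norm_sub_sq_real, real_inner_comm]
  simp_rw [key]
  have i3 : Integrable (fun ω => ‖g ω‖ ^ 2 - 2 * (inner ℝ (Y ω) (g ω) : ℝ)) P :=
    h1.sub (i1.const_mul 2)
  rw [integral_add i3 h2, integral_sub h1 (i1.const_mul 2), integral_const_mul, e]
  simp only [real_inner_self_eq_norm_sq]
  ring

lemma aux_convex {E : Type*} [NormedAddCommGroup E] [InnerProductSpace ℝ E] [CompleteSpace E]
    {S : Set E} {f : E → ℝ} (hf : ConvexOn ℝ S f) {x y : E} (hx : x ∈ S) (hy : y ∈ S)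
    (hd : DifferentiableAt ℝ f x) : f x - f y ≤ inner ℝ (gradient f x) (x - y) := by
  have hc : ConvexOn ℝ (Set.Icc (0:ℝ) 1) (fun t : ℝ => f (AffineMap.lineMap x y t)) := by
    refine (hf.comp_affineMap (AffineMap.lineMap x y)).subset ?_ (convex_Icc 0 1)
    intro t ht
    exact hf.1.lineMap_mem hx hy ht
  have hder : HasDerivAt (fun t : ℝ => f (AffineMap.lineMap x y t))
      (inner ℝ (gradient f x) (y - x)) 0 := by
    have h1 : HasFDerivAt f (InnerProductSpace.toDual ℝ E (gradient f x)) 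
      (AffineMap.lineMap x y (0:ℝ)) := by
      simpa using hd.hasGradientAt.hasFDerivAt
    have h2 : HasDerivAt (fun t : ℝ => (AffineMap.lineMap x y t : E)) (y - x) 0 :=
      AffineMap.hasDerivAt_lineMap
    exact h1.comp_hasDerivAt (0:ℝ) h2
  have := hc.le_slope_of_hasDerivAt (x := 0) (y := 1) (by simp) (by simp) one_pos hder
  simp only [slope_def_field, AffineMap.lineMap_apply_one, AffineMap.lineMap_apply_zero,
    sub_zero, div_one] at this
  rw [← neg_sub y x, inner_neg_right]
  linarith

lemma aux_bdd {E Ω : Type*} [NormedAddCommGroup E] 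
    {m0 : MeasurableSpace Ω} {P : Measure Ω} [IsProbabilityMeasure P]
    {S : Set E} (hS : IsCompact S) {u : Ω → E} (hu : AEStronglyMeasurable u P)
    (h : ∀ ω, u ω ∈ S) (c : E) : MemLp (fun ω => u ω - c) 2 P := by
  obtain ⟨C, hC⟩ := hS.isBounded.exists_norm_le
  exact (MemLp.of_bound hu C (Filter.Eventually.of_forall fun ω => hC _ (h ω))).sub (memLp_const c)

lemma aux_proj {E : Type*} [NormedAddCommGroup E] [InnerProductSpace ℝ E] (a b g c : E) (η : ℝ) :
     ‖b - c‖ ^ 2 + ‖(a - η • g) - b‖ ^ 2 = ‖a - c‖ ^ 2 - 2 * η * (inner ℝ (a - c) g : ℝ)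
       + η ^ 2 * ‖g‖ ^ 2 + 2 * (inner ℝ ((a - η • g) - b) (c - b) : ℝ) := by
  have e1 : b - c = (a - c) - η • g - ((a - η • g) - b) := by abel
  have e2 : c - b = ((a - η • g) - b) - ((a - c) - η • g) := by abel
  rw [e2, e1]
  generalize (a - η • g) - b = p
  generalize a - c = q
  rw [norm_sub_sq_real, norm_sub_sq_real, inner_sub_right p, real_inner_self_eq_norm_sq,
    real_inner_comm p, norm_smul, inner_smul_right, mul_pow, Real.norm_eq_abs, sq_abs]
  ring

lemma aux_step {E₁ E₂ : Type*} [NormedAddCommGroup E₁] [InnerProductSpace ℝ E₁]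
    [NormedAddCommGroup E₂] [InnerProductSpace ℝ E₂] (a b g c : E₁) (a' b' g' c' : E₂) (η : ℝ)
    (h : (inner ℝ ((a - η • g) - b) (c - b) : ℝ)
      + (inner ℝ ((a' - η • g') - b') (c' - b') : ℝ) ≤ 0) :
    ‖b - c‖ ^ 2 + ‖b' - c'‖ ^ 2 ≤ (‖a - c‖ ^ 2 + ‖a' - c'‖ ^ 2)
      - 2 * η * ((inner ℝ (a - c) g : ℝ) + (inner ℝ (a' - c') g' : ℝ))
      + η ^ 2 * (‖g‖ ^ 2 + ‖g'‖ ^ 2) := by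
  have k1 := aux_proj a b g c η
  have k2 := aux_proj a' b' g' c' η
  nlinarith [sq_nonneg ‖(a - η • g) - b‖, sq_nonneg ‖(a' - η • g') - b'‖]

lemma aux_young {E : Type*} [NormedAddCommGroup E] [InnerProductSpace ℝ E] (q g : E) (η : ℝ)
    (hη : 0 < η) : (inner ℝ q g : ℝ) ≤ ‖q‖ ^ 2 / (2 * η) + η / 2 * ‖g‖ ^ 2 := by
  have h := sq_nonneg ‖q - η • g‖
  rw [norm_sub_sq_real, norm_smul, inner_smul_right, mul_pow, Real.norm_eq_abs, sq_abs] at h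
  have : ‖q‖ ^ 2 / (2 * η) + η / 2 * ‖g‖ ^ 2 - (inner ℝ q g : ℝ)
      = (‖q‖ ^ 2 - 2 * (η * inner ℝ q g) + η ^ 2 * ‖g‖ ^ 2) / (2 * η) := by
    field_simp
    ring
  have : 0 ≤ (‖q‖ ^ 2 - 2 * (η * inner ℝ q g) + η ^ 2 * ‖g‖ ^ 2) / (2 * η) := by positivity
  linarith

/-- stochastic gradient descent ascent. With projected iterates driven by
stochastic saddle-operator estimates `∇_t = (g_t, h_t)` that are unbiased
(`E[∇_t | 𝔉_{t−1}] = G(z_{t−1})`) and have variance at most `τ²`, the average iterate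
`(w̄, θ̄)` satisfies, for every `(w,θ) ∈ W × Θ`,
`E[F(w̄,θ) − F(w,θ̄)] ≤ ‖z₀ − (w,θ)‖²/(2ηT) + (η/2)(L² + τ²)`. -/
theorem sgda_convergence {d₁ d₂ : ℕ}
    (W : Set (EuclideanSpace ℝ (Fin d₁))) (Θ : Set (EuclideanSpace ℝ (Fin d₂)))
    (hWne : W.Nonempty) (hΘne : Θ.Nonempty)
    (hWcomp : IsCompact W) (hΘcomp : IsCompact Θ)
    (hWconv : Convex ℝ W) (hΘconv : Convex ℝ Θ)
    (F : EuclideanSpace ℝ (Fin d₁) → EuclideanSpace ℝ (Fin d₂) → ℝ)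
    (hFdiff : Differentiable ℝ
      (fun p : EuclideanSpace ℝ (Fin d₁) × EuclideanSpace ℝ (Fin d₂) => F p.1 p.2))
    (hconv : ∀ θ ∈ Θ, ConvexOn ℝ W (fun w => F w θ))
    (hconc : ∀ w ∈ W, ConcaveOn ℝ Θ (fun θ => F w θ))
    -- the saddle operator `G = (Gw, Gθ) = (∇_w F, −∇_θ F)`
    (Gw : EuclideanSpace ℝ (Fin d₁) → EuclideanSpace ℝ (Fin d₂) → EuclideanSpace ℝ (Fin d₁))
    (Gθ : EuclideanSpace ℝ (Fin d₁) → EuclideanSpace ℝ (Fin d₂) → EuclideanSpace ℝ (Fin d₂))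
    (hGw : ∀ w θ, Gw w θ = gradient (fun w' => F w' θ) w)
    (hGθ : ∀ w θ, Gθ w θ = -gradient (fun θ' => F w θ') θ)
    (L : ℝ)
    (hGbound : ∀ w ∈ W, ∀ θ ∈ Θ, Real.sqrt (‖Gw w θ‖ ^ 2 + ‖Gθ w θ‖ ^ 2) ≤ L)
    {Ω : Type*} {m0 : MeasurableSpace Ω} (P : Measure Ω) [IsProbabilityMeasure P]
    (ℱ : Filtration ℕ m0)
    (T : ℕ) (hT : 0 < T) (η : ℝ) (hη : 0 < η) (τ : ℝ)
    -- the iterates `z_t = (w_t, θ_t)` and the stochastic estimates `∇_t = (g_t, h_t)`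
    (w : ℕ → Ω → EuclideanSpace ℝ (Fin d₁)) (θ : ℕ → Ω → EuclideanSpace ℝ (Fin d₂))
    (g : ℕ → Ω → EuclideanSpace ℝ (Fin d₁)) (h : ℕ → Ω → EuclideanSpace ℝ (Fin d₂))
    (w0 : EuclideanSpace ℝ (Fin d₁)) (θ0 : EuclideanSpace ℝ (Fin d₂))
    (hw0 : w0 ∈ W) (hθ0 : θ0 ∈ Θ)
    (hinit : ∀ ω, w 0 ω = w0 ∧ θ 0 ω = θ0)
    (hiter_mem : ∀ t (ω : Ω), w t ω ∈ W ∧ θ t ω ∈ Θ)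
    (hadapted : ∀ t, Measurable[ℱ t] (w t) ∧ Measurable[ℱ t] (θ t))
    (hgmeas : ∀ t, 1 ≤ t → t < T → Measurable[ℱ t] (g t) ∧ Measurable[ℱ t] (h t))
    (hgL2 : ∀ t, 1 ≤ t → t < T → MemLp (g t) 2 P ∧ MemLp (h t) 2 P)
    -- `z_t` is the Euclidean projection of `z_{t−1} − η∇_t` onto `C = W × Θ`
    (hproj : ∀ t, 1 ≤ t → t < T → ∀ (ω : Ω), ∀ w' ∈ W, ∀ θ' ∈ Θ,
      (inner ℝ ((w (t - 1) ω - η • g t ω) - w t ω) (w' - w t ω) : ℝ)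
        + (inner ℝ ((θ (t - 1) ω - η • h t ω) - θ t ω) (θ' - θ t ω) : ℝ) ≤ 0)
    -- unbiasedness: `E[∇_t | 𝔉_{t−1}] = G(z_{t−1})` a.s.
    (hunbiased : ∀ t, 1 ≤ t → t < T →
      (P[g t | ℱ (t - 1)] =ᵐ[P] fun ω => Gw (w (t - 1) ω) (θ (t - 1) ω))
      ∧ (P[h t | ℱ (t - 1)] =ᵐ[P] fun ω => Gθ (w (t - 1) ω) (θ (t - 1) ω)))
    -- bounded variance: `E[‖∇_t − G(z_{t−1})‖²] ≤ τ²`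
    (hvar : ∀ t, 1 ≤ t → t < T →
      ∫ ω, (‖g t ω - Gw (w (t - 1) ω) (θ (t - 1) ω)‖ ^ 2
        + ‖h t ω - Gθ (w (t - 1) ω) (θ (t - 1) ω)‖ ^ 2) ∂P ≤ τ ^ 2) :
    ∀ w' ∈ W, ∀ θ' ∈ Θ,
      (∫ ω, (F ((T : ℝ)⁻¹ • ∑ t ∈ Finset.range T, w t ω) θ'
          - F w' ((T : ℝ)⁻¹ • ∑ t ∈ Finset.range T, θ t ω)) ∂P)
        ≤ (‖w0 - w'‖ ^ 2 + ‖θ0 - θ'‖ ^ 2) / (2 * η * T) + (η / 2) * (L ^ 2 + τ ^ 2) := by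
  intro w' hw' θ' hθ'
  have hwm : ∀ t, AEStronglyMeasurable[ℱ t] (w t) P := fun t =>
    (hadapted t).1.stronglyMeasurable.aestronglyMeasurable
  have hθm : ∀ t, AEStronglyMeasurable[ℱ t] (θ t) P := fun t =>
    (hadapted t).2.stronglyMeasurable.aestronglyMeasurable
  have hwm0 : ∀ t, Measurable (w t) := fun t => (hadapted t).1.mono (ℱ.le t) le_rfl
  have hθm0 : ∀ t, Measurable (θ t) := fun t => (hadapted t).2.mono (ℱ.le t) le_rfl
  have hwL : ∀ t, MemLp (fun ω => w t ω - w') 2 P := fun t =>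
    aux_bdd hWcomp (hwm0 t).aestronglyMeasurable (fun ω => (hiter_mem t ω).1) w'
  have hθL : ∀ t, MemLp (fun ω => θ t ω - θ') 2 P := fun t =>
    aux_bdd hΘcomp (hθm0 t).aestronglyMeasurable (fun ω => (hiter_mem t ω).2) θ'
  have hG2 : ∀ t ω, ‖Gw (w t ω) (θ t ω)‖ ^ 2 + ‖Gθ (w t ω) (θ t ω)‖ ^ 2 ≤ L ^ 2 := by
    intro t ω
    have := hGbound _ (hiter_mem t ω).1 _ (hiter_mem t ω).2
    exact (Real.sqrt_le_left ((Real.sqrt_nonneg _).trans this)).1 this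
  let D : ℕ → Ω → ℝ := fun t ω => ‖w t ω - w'‖ ^ 2 + ‖θ t ω - θ'‖ ^ 2
  let Z : ℕ → Ω → ℝ := fun t ω => (inner ℝ (w t ω - w') (Gw (w t ω) (θ t ω)) : ℝ)
    + (inner ℝ (θ t ω - θ') (Gθ (w t ω) (θ t ω)) : ℝ)
  have hD : ∀ t, Integrable (D t) P := fun t =>
    ((memLp_two_iff_integrable_sq_norm (hwL t).1).1 (hwL t)).add
      ((memLp_two_iff_integrable_sq_norm (hθL t).1).1 (hθL t))
  have hstep : ∀ t, t + 1 < T → Integrable (Z t) P ∧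
      ∫ ω, D (t + 1) ω ∂P ≤ ∫ ω, D t ω ∂P - 2 * η * ∫ ω, Z t ω ∂P
        + η ^ 2 * (L ^ 2 + τ ^ 2) := by
    intro t ht
    have h1 : 1 ≤ t + 1 := by omega
    obtain ⟨hg2, hh2⟩ := hgL2 (t + 1) h1 ht
    obtain ⟨hug, huh⟩ := hunbiased (t + 1) h1 ht
    have hv := hvar (t + 1) h1 ht
    have hp := hproj (t + 1) h1 ht
    simp only [Nat.add_sub_cancel] at hug huh hv hp
    obtain ⟨gY, gi, gYi, gs, ge⟩ := aux_var (ℱ.le t) hg2 hug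
    obtain ⟨hY, hi, hYi, hs, he⟩ := aux_var (ℱ.le t) hh2 huh
    have pg := aux_pull (ℱ.le t) (hwL t) ((hwm t).sub aestronglyMeasurable_const) hg2 hug
    have ph := aux_pull (ℱ.le t) (hθL t) ((hθm t).sub aestronglyMeasurable_const) hh2 huh
    have ig := aux_inner_int (hwL t) hg2
    have ih := aux_inner_int (hθL t) hh2
    have igY := aux_inner_int (hwL t) gY
    have ihY := aux_inner_int (hθL t) hY
    have hZi : Integrable (Z t) P := igY.add ihY
    refine ⟨hZi, ?_⟩
    have hZe : ∫ ω, Z t ω ∂P = ∫ ω, ((inner ℝ (w t ω - w') (g (t + 1) ω) : ℝ)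
        + (inner ℝ (θ t ω - θ') (h (t + 1) ω) : ℝ)) ∂P := by
      rw [integral_add ig ih, pg, ph, ← integral_add igY ihY]
    have hQi : Integrable (fun ω => (inner ℝ (w t ω - w') (g (t + 1) ω) : ℝ)
        + (inner ℝ (θ t ω - θ') (h (t + 1) ω) : ℝ)) P := ig.add ih
    have hNi : Integrable (fun ω => ‖g (t + 1) ω‖ ^ 2 + ‖h (t + 1) ω‖ ^ 2) P := gi.add hi
    have hN : ∫ ω, (‖g (t + 1) ω‖ ^ 2 + ‖h (t + 1) ω‖ ^ 2) ∂P ≤ L ^ 2 + τ ^ 2 := by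
      rw [integral_add gi hi, ge, he]
      rw [integral_add gs hs] at hv
      have : ∫ ω, (‖Gw (w t ω) (θ t ω)‖ ^ 2 + ‖Gθ (w t ω) (θ t ω)‖ ^ 2) ∂P
          ≤ ∫ _, L ^ 2 ∂P :=
        integral_mono (gYi.add hYi) (integrable_const _) (fun ω => hG2 t ω)
      rw [integral_add gYi hYi] at this
      simp only [integral_const, probReal_univ, smul_eq_mul, one_mul] at this
      linarith
    have hR1 : Integrable (fun ω => D t ω - 2 * η * ((inner ℝ (w t ω - w') (g (t + 1) ω) : ℝ)
        + (inner ℝ (θ t ω - θ') (h (t + 1) ω) : ℝ))) P := (hD t).sub (hQi.const_mul _)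
    have hR2 : Integrable (fun ω => D t ω - 2 * η * ((inner ℝ (w t ω - w') (g (t + 1) ω) : ℝ)
        + (inner ℝ (θ t ω - θ') (h (t + 1) ω) : ℝ))
        + η ^ 2 * (‖g (t + 1) ω‖ ^ 2 + ‖h (t + 1) ω‖ ^ 2)) P := hR1.add (hNi.const_mul _)
    have hm := integral_mono (hD (t + 1)) hR2
      (fun ω => aux_step _ _ _ _ _ _ _ _ η (hp ω w' hw' θ' hθ'))
    rw [integral_add hR1 (hNi.const_mul _), integral_sub (hD t) (hQi.const_mul _),
      integral_const_mul, integral_const_mul, ← hZe] at hm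
    have := mul_le_mul_of_nonneg_left hN (sq_nonneg η)
    linarith
  have hsum : ∀ n, n < T → 2 * η * ∑ t ∈ Finset.range n, ∫ ω, Z t ω ∂P + ∫ ω, D n ω ∂P
      ≤ (‖w0 - w'‖ ^ 2 + ‖θ0 - θ'‖ ^ 2) + n * (η ^ 2 * (L ^ 2 + τ ^ 2)) := by
    intro n
    induction n with
    | zero =>
      intro _
      simp [D, hinit]
    | succ k ih =>
      intro hk
      have h1 := ih (by omega)
      have h2 := (hstep k hk).2
      rw [Finset.sum_range_succ]
      push_cast
      linarith
  have hFw : ∀ θ₁, Differentiable ℝ (fun w₁ => F w₁ θ₁) := fun θ₁ =>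
    hFdiff.comp (differentiable_id.prodMk (differentiable_const θ₁))
  have hFθ : ∀ w₁, Differentiable ℝ (fun θ₁ => F w₁ θ₁) := fun w₁ =>
    hFdiff.comp ((differentiable_const w₁).prodMk differentiable_id)
  have hgap : ∀ t ω, F (w t ω) θ' - F w' (θ t ω) ≤ Z t ω := by
    intro t ω
    obtain ⟨m1, m2⟩ := hiter_mem t ω
    have a1 := aux_convex (hconv _ m2) m1 hw' (hFw _ _)
    have a2 := aux_convex (hconc _ m1).neg m2 hθ' (hFθ _ _).neg
    have e : gradient (-fun θ₁ => F (w t ω) θ₁) (θ t ω) = Gθ (w t ω) (θ t ω) := by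
      rw [hGθ]
      simp [gradient, fderiv_neg]
    rw [e] at a2
    rw [← hGw] at a1
    simp only [Pi.neg_apply] at a2
    simp only [Z]
    rw [real_inner_comm (Gw _ _), real_inner_comm (Gθ _ _)]
    linarith
  obtain ⟨n, rfl⟩ : ∃ n, T = n + 1 := ⟨T - 1, by omega⟩
  have hTpos : (0 : ℝ) < ((n + 1 : ℕ) : ℝ) := by exact_mod_cast hT
  set c : ℝ := (((n + 1 : ℕ) : ℝ))⁻¹ with hc
  have hcpos : 0 < c := inv_pos.2 hTpos
  have hc1 : ∑ t ∈ Finset.range (n + 1), c = 1 := by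
    rw [Finset.sum_const, Finset.card_range, nsmul_eq_mul, hc, mul_inv_cancel₀ hTpos.ne']
  have hwbar : ∀ ω, c • ∑ t ∈ Finset.range (n + 1), w t ω ∈ W := by
    intro ω
    rw [Finset.smul_sum]
    exact hWconv.sum_mem (fun _ _ => hcpos.le) hc1 (fun t _ => (hiter_mem t ω).1)
  have hθbar : ∀ ω, c • ∑ t ∈ Finset.range (n + 1), θ t ω ∈ Θ := by
    intro ω
    rw [Finset.smul_sum]
    exact hΘconv.sum_mem (fun _ _ => hcpos.le) hc1 (fun t _ => (hiter_mem t ω).2)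
  have hpt : ∀ ω, F (c • ∑ t ∈ Finset.range (n + 1), w t ω) θ'
      - F w' (c • ∑ t ∈ Finset.range (n + 1), θ t ω)
      ≤ c * (∑ t ∈ Finset.range n, Z t ω + (D n ω * (2 * η)⁻¹ + η / 2 * L ^ 2)) := by
    intro ω
    have j1 := (hconv θ' hθ').map_sum_le (t := Finset.range (n + 1)) (w := fun _ => c)
      (p := fun t => w t ω) (fun _ _ => hcpos.le) hc1 (fun t _ => (hiter_mem t ω).1)
    have j2 := (hconc w' hw').le_map_sum (t := Finset.range (n + 1)) (w := fun _ => c)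
      (p := fun t => θ t ω) (fun _ _ => hcpos.le) hc1 (fun t _ => (hiter_mem t ω).2)
    simp only [← Finset.smul_sum, smul_eq_mul, ← Finset.mul_sum] at j1 j2
    have j3 : ∑ t ∈ Finset.range (n + 1), F (w t ω) θ' - ∑ t ∈ Finset.range (n + 1), F w' (θ t ω)
        ≤ ∑ t ∈ Finset.range (n + 1), Z t ω := by
      rw [← Finset.sum_sub_distrib]
      exact Finset.sum_le_sum fun t _ => hgap t ω
    rw [Finset.sum_range_succ (fun t => Z t ω)] at j3
    have j4 : Z n ω ≤ D n ω * (2 * η)⁻¹ + η / 2 * L ^ 2 := by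
      have y1 := aux_young (w n ω - w') (Gw (w n ω) (θ n ω)) η hη
      have y2 := aux_young (θ n ω - θ') (Gθ (w n ω) (θ n ω)) η hη
      have y3 := mul_le_mul_of_nonneg_left (hG2 n ω) (half_pos hη).le
      rw [div_eq_mul_inv] at y1 y2
      simp only [Z, D]
      linarith
    have j5 := mul_le_mul_of_nonneg_left (j3.trans (add_le_add_right j4 _)) hcpos.le
    rw [mul_sub] at j5
    linarith
  have hZs : Integrable (fun ω => ∑ t ∈ Finset.range n, Z t ω) P :=
    integrable_finsetSum _ fun t ht => (hstep t (by have := Finset.mem_range.1 ht; omega)).1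
  have hDs : Integrable (fun ω => D n ω * (2 * η)⁻¹ + η / 2 * L ^ 2) P :=
    ((hD n).mul_const _).add (integrable_const _)
  have hL1 : Integrable (fun ω => F (c • ∑ t ∈ Finset.range (n + 1), w t ω) θ') P := by
    obtain ⟨C, hC⟩ := (hWcomp.image (hFw θ').continuous).isBounded.exists_norm_le
    refine Integrable.of_bound (C := C) ?_ (Filter.Eventually.of_forall fun ω =>
      hC _ ⟨_, hwbar ω, rfl⟩)
    exact ((hFw θ').continuous.measurable.comp
      ((Finset.measurable_fun_sum _ fun t _ => hwm0 t).const_smul c)).aestronglyMeasurable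
  have hL2 : Integrable (fun ω => F w' (c • ∑ t ∈ Finset.range (n + 1), θ t ω)) P := by
    obtain ⟨C, hC⟩ := (hΘcomp.image (hFθ w').continuous).isBounded.exists_norm_le
    refine Integrable.of_bound (C := C) ?_ (Filter.Eventually.of_forall fun ω =>
      hC _ ⟨_, hθbar ω, rfl⟩)
    exact ((hFθ w').continuous.measurable.comp
      ((Finset.measurable_fun_sum _ fun t _ => hθm0 t).const_smul c)).aestronglyMeasurable
  have hfin := integral_mono (hL1.sub hL2) ((hZs.add hDs).const_mul c) hpt
  simp only [Pi.sub_apply, Pi.add_apply] at hfin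
  refine hfin.trans ?_
  rw [integral_const_mul, integral_add hZs hDs,
    integral_add ((hD n).mul_const _) (integrable_const _), integral_mul_const,
    integral_finsetSum _ fun t ht => (hstep t (by have := Finset.mem_range.1 ht; omega)).1]
  simp only [integral_const, probReal_univ, smul_eq_mul, one_mul]
  have hs := hsum n (by omega)
  generalize ∑ t ∈ Finset.range n, ∫ ω, Z t ω ∂P = A at hs ⊢
  generalize ∫ ω, D n ω ∂P = B at hs ⊢
  generalize ‖w0 - w'‖ ^ 2 + ‖θ0 - θ'‖ ^ 2 = K at hs ⊢
  have e1 : c * (A + (B * (2 * η)⁻¹ + η / 2 * L ^ 2))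
      = (2 * η * A + B + η ^ 2 * L ^ 2) / (2 * η * ((n + 1 : ℕ) : ℝ)) := by
    rw [hc]
    field_simp
    ring
  have e2 : K / (2 * η * ((n + 1 : ℕ) : ℝ)) + η / 2 * (L ^ 2 + τ ^ 2)
      = (K + ((n + 1 : ℕ) : ℝ) * (η ^ 2 * (L ^ 2 + τ ^ 2))) / (2 * η * ((n + 1 : ℕ) : ℝ)) := by
    field_simp
  rw [e1, e2]
  refine div_le_div_of_nonneg_right ?_ (by positivity)
  push_cast
  nlinarith [mul_nonneg (sq_nonneg η) (sq_nonneg τ)]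
end

section
/- (Deterministic projected gradient descent ascent.) Let z₀ ∈ C, η > 0, T a positive integer, and define iterates z₁, …, z_{T−1} by requiring, for each t ≥ 1, that z_t ∈ C and ⟨(z_{t−1} − η·G(z_{t−1})) − z_t, z − z_t⟩ ≤ 0 for all z ∈ C (i.e. z_t is the Euclidean projection of z_{t−1} − η·G(z_{t−1}) onto C). Write z_t = (w_t, θ_t) and let (w̄, θ̄) := (1/T)Σ_{t=0}^{T−1}(w_t, θ_t). Then for every (w, θ) ∈ C: F(w̄, θ) − F(w, θ̄) ≤ ‖z₀ − (w,θ)‖²/(2ηT) + η·L²/2. -/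
lemma gda_grad_ineq {d : ℕ} {W : Set (EuclideanSpace ℝ (Fin d))}
    {f : EuclideanSpace ℝ (Fin d) → ℝ} (hf : ConvexOn ℝ W f)
    {x y : EuclideanSpace ℝ (Fin d)} (hx : x ∈ W) (hy : y ∈ W)
    (hd : DifferentiableAt ℝ f x) : f x - f y ≤ inner ℝ (gradient f x) (x - y) := by
  have hφ : ConvexOn ℝ (Set.Icc (0:ℝ) 1) (fun s : ℝ => f (AffineMap.lineMap x y s)) := by
    refine (hf.comp_affineMap (AffineMap.lineMap x y)).subset ?_ (convex_Icc 0 1)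
    intro s hs
    exact hf.1.lineMap_mem hx hy hs
  have hder : HasDerivAt (fun s : ℝ => f (AffineMap.lineMap x y s))
      (inner ℝ (gradient f x) (y - x)) 0 := by
    have h1 : HasFDerivAt f (InnerProductSpace.toDual ℝ _ (gradient f x))
        (AffineMap.lineMap x y (0:ℝ)) := by
      rw [AffineMap.lineMap_apply_zero]
      exact hd.hasGradientAt.hasFDerivAt
    have h2 : HasDerivAt (fun s : ℝ => AffineMap.lineMap x y s) (y - x) (0:ℝ) :=
      AffineMap.hasDerivAt_lineMap
    have h3 := h1.comp_hasDerivAt (0:ℝ) h2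
    exact h3
  have h := hφ.le_slope_of_hasDerivAt (x := 0) (y := 1) (by simp) (by simp) (by norm_num) hder
  simp only [slope_def_field, AffineMap.lineMap_apply_zero, AffineMap.lineMap_apply_one, sub_zero, div_one] at h
  rw [← neg_sub y x, inner_neg_right]
  linarith

lemma gda_step {d : ℕ} (a b u g : EuclideanSpace ℝ (Fin d)) (η : ℝ) :
    2 * η * inner ℝ g (a - u) ≤ ‖a - u‖ ^ 2 - ‖b - u‖ ^ 2 + η ^ 2 * ‖g‖ ^ 2
      + 2 * inner ℝ ((a - η • g) - b) (u - b) := by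
  have h0 := sq_nonneg ‖a - η • g - b‖
  have h1 : ‖(a - u) - η • g‖ ^ 2 = ‖a - u‖ ^ 2 - 2 * (η * inner ℝ g (a - u)) + η ^ 2 * ‖g‖ ^ 2 := by
    rw [norm_sub_sq_real, inner_smul_right, norm_smul, mul_pow, real_inner_comm, Real.norm_eq_abs,
      sq_abs]
  have h2 : ‖(a - η • g - b) - (u - b)‖ ^ 2 = _ := norm_sub_sq_real _ _
  have h3 : (a - η • g - b) - (u - b) = (a - u) - η • g := by abel
  rw [h3, h1, norm_sub_rev u b] at h2
  linarith

lemma gda_last {d : ℕ} (a u g : EuclideanSpace ℝ (Fin d)) (η : ℝ) :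
    2 * η * inner ℝ g (a - u) ≤ ‖a - u‖ ^ 2 + η ^ 2 * ‖g‖ ^ 2 := by
  have h := gda_step a u u g η
  simp at h
  linarith

/-- deterministic projected gradient descent ascent. With iterates
`z_t = Π_C(z_{t−1} − η·G(z_{t−1}))` (characterized by the variational inequality of
the Euclidean projection), the average iterate `(w̄, θ̄)` satisfies, for every
`(w,θ) ∈ C = W × Θ`, `F(w̄,θ) − F(w,θ̄) ≤ ‖z₀ − (w,θ)‖²/(2ηT) + η·L²/2`. -/
theorem gda_convergence {d₁ d₂ : ℕ}
    (W : Set (EuclideanSpace ℝ (Fin d₁))) (Θ : Set (EuclideanSpace ℝ (Fin d₂)))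
    (hWne : W.Nonempty) (hΘne : Θ.Nonempty)
    (hWcomp : IsCompact W) (hΘcomp : IsCompact Θ)
    (hWconv : Convex ℝ W) (hΘconv : Convex ℝ Θ)
    (F : EuclideanSpace ℝ (Fin d₁) → EuclideanSpace ℝ (Fin d₂) → ℝ)
    (hFdiff : Differentiable ℝ
      (fun p : EuclideanSpace ℝ (Fin d₁) × EuclideanSpace ℝ (Fin d₂) => F p.1 p.2))
    (hconv : ∀ θ ∈ Θ, ConvexOn ℝ W (fun w => F w θ))
    (hconc : ∀ w ∈ W, ConcaveOn ℝ Θ (fun θ => F w θ))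
    -- the saddle operator `G = (Gw, Gθ) = (∇_w F, −∇_θ F)`
    (Gw : EuclideanSpace ℝ (Fin d₁) → EuclideanSpace ℝ (Fin d₂) → EuclideanSpace ℝ (Fin d₁))
    (Gθ : EuclideanSpace ℝ (Fin d₁) → EuclideanSpace ℝ (Fin d₂) → EuclideanSpace ℝ (Fin d₂))
    (hGw : ∀ w θ, Gw w θ = gradient (fun w' => F w' θ) w)
    (hGθ : ∀ w θ, Gθ w θ = -gradient (fun θ' => F w θ') θ)
    (L : ℝ)
    (hGbound : ∀ w ∈ W, ∀ θ ∈ Θ, Real.sqrt (‖Gw w θ‖ ^ 2 + ‖Gθ w θ‖ ^ 2) ≤ L)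
    (T : ℕ) (hT : 0 < T) (η : ℝ) (hη : 0 < η)
    (w : ℕ → EuclideanSpace ℝ (Fin d₁)) (θ : ℕ → EuclideanSpace ℝ (Fin d₂))
    (hinit : w 0 ∈ W ∧ θ 0 ∈ Θ)
    (hiter_mem : ∀ t, w t ∈ W ∧ θ t ∈ Θ)
    -- `z_t` is the Euclidean projection of `z_{t−1} − η·G(z_{t−1})` onto `C = W × Θ`
    (hproj : ∀ t, 1 ≤ t → t < T → ∀ w' ∈ W, ∀ θ' ∈ Θ,
      (inner ℝ ((w (t - 1) - η • Gw (w (t - 1)) (θ (t - 1))) - w t) (w' - w t) : ℝ)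
        + (inner ℝ ((θ (t - 1) - η • Gθ (w (t - 1)) (θ (t - 1))) - θ t) (θ' - θ t) : ℝ) ≤ 0) :
    ∀ w' ∈ W, ∀ θ' ∈ Θ,
      F ((T : ℝ)⁻¹ • ∑ t ∈ Finset.range T, w t) θ'
          - F w' ((T : ℝ)⁻¹ • ∑ t ∈ Finset.range T, θ t)
        ≤ (‖w 0 - w'‖ ^ 2 + ‖θ 0 - θ'‖ ^ 2) / (2 * η * T) + η * L ^ 2 / 2 := by
  intro w' hw' θ' hθ'
  have hTr : (0:ℝ) < T := by exact_mod_cast hT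
  have hdw : ∀ a b, DifferentiableAt ℝ (fun x => F x b) a := fun a b =>
    (hFdiff (a, b)).comp a (f := fun x => (x, b)) (by fun_prop)
  have hdθ : ∀ a b, DifferentiableAt ℝ (fun y => F a y) b := fun a b =>
    (hFdiff (a, b)).comp b (f := fun y => (a, y)) (by fun_prop)
  have hG2 : ∀ t, ‖Gw (w t) (θ t)‖ ^ 2 + ‖Gθ (w t) (θ t)‖ ^ 2 ≤ L ^ 2 := fun t =>
    (Real.sqrt_le_left ((Real.sqrt_nonneg _).trans
      (hGbound _ (hiter_mem t).1 _ (hiter_mem t).2))).1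
      (hGbound _ (hiter_mem t).1 _ (hiter_mem t).2)
  set g : ℕ → ℝ := fun t => inner ℝ (Gw (w t) (θ t)) (w t - w')
    + inner ℝ (Gθ (w t) (θ t)) (θ t - θ') with hg
  have hgap : ∀ t, F (w t) θ' - F w' (θ t) ≤ g t := by
    intro t
    have h1 := gda_grad_ineq (hconv _ (hiter_mem t).2) (hiter_mem t).1 hw' (hdw _ _)
    have h2 := gda_grad_ineq (hconc _ (hiter_mem t).1).neg (hiter_mem t).2 hθ' (hdθ _ _).neg
    have h3 : gradient (-(fun y => F (w t) y)) (θ t) = Gθ (w t) (θ t) := by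
      rw [hGθ, gradient, gradient, fderiv_neg, map_neg]
    rw [h3] at h2
    rw [← hGw] at h1
    simp only [Pi.neg_apply] at h2
    simp only [hg]
    linarith
  have hsum : ∀ n, n < T → 2 * η * ∑ t ∈ Finset.range n, g t ≤
      (‖w 0 - w'‖ ^ 2 + ‖θ 0 - θ'‖ ^ 2) - (‖w n - w'‖ ^ 2 + ‖θ n - θ'‖ ^ 2)
        + n * (η ^ 2 * L ^ 2) := by
    intro n
    induction n with
    | zero => intro _; simp
    | succ n ih =>
      intro hn
      have h0 := ih (by omega)
      have hp := hproj (n + 1) (by omega) hn w' hw' θ' hθ'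
      simp only [Nat.add_sub_cancel] at hp
      have h1 := gda_step (w n) (w (n+1)) w' (Gw (w n) (θ n)) η
      have h2 := gda_step (θ n) (θ (n+1)) θ' (Gθ (w n) (θ n)) η
      have h3 := mul_le_mul_of_nonneg_left (hG2 n) (sq_nonneg η)
      rw [Finset.sum_range_succ]
      push_cast
      simp only [hg] at h0 ⊢
      linarith
  have hfin : 2 * η * ∑ t ∈ Finset.range T, g t ≤
      (‖w 0 - w'‖ ^ 2 + ‖θ 0 - θ'‖ ^ 2) + T * (η ^ 2 * L ^ 2) := by
    obtain ⟨n, rfl⟩ : ∃ n, T = n + 1 := ⟨T - 1, by omega⟩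
    have h0 := hsum n (by omega)
    have h1 := gda_last (w n) w' (Gw (w n) (θ n)) η
    have h2 := gda_last (θ n) θ' (Gθ (w n) (θ n)) η
    have h3 := mul_le_mul_of_nonneg_left (hG2 n) (sq_nonneg η)
    rw [Finset.sum_range_succ]
    push_cast
    simp only [hg] at h0 ⊢
    linarith
  have hw1 : ∑ t ∈ Finset.range T, (T:ℝ)⁻¹ = 1 := by
    simp [hTr.ne']
  have hJ1 := (hconv θ' hθ').map_sum_le (t := Finset.range T) (w := fun _ => (T:ℝ)⁻¹) (p := w)
    (fun _ _ => by positivity) hw1 (fun t _ => (hiter_mem t).1)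
  have hJ2 := (hconc w' hw').le_map_sum (t := Finset.range T) (w := fun _ => (T:ℝ)⁻¹) (p := θ)
    (fun _ _ => by positivity) hw1 (fun t _ => (hiter_mem t).2)
  simp only [← Finset.smul_sum, smul_eq_mul, ← Finset.mul_sum] at hJ1 hJ2
  have hS : ∑ t ∈ Finset.range T, F (w t) θ' - ∑ t ∈ Finset.range T, F w' (θ t)
      ≤ ∑ t ∈ Finset.range T, g t := by
    rw [← Finset.sum_sub_distrib]
    exact Finset.sum_le_sum fun t _ => hgap t
  have hS2 := mul_le_mul_of_nonneg_left hS (inv_nonneg.2 hTr.le)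
  have hE : (T:ℝ)⁻¹ * ∑ t ∈ Finset.range T, g t ≤
      (‖w 0 - w'‖ ^ 2 + ‖θ 0 - θ'‖ ^ 2) / (2 * η * T) + η * L ^ 2 / 2 := by
    have e1 : (T:ℝ)⁻¹ * ∑ t ∈ Finset.range T, g t
        = (2 * η * ∑ t ∈ Finset.range T, g t) / (2 * η * T) := by field_simp
    have e2 : (‖w 0 - w'‖ ^ 2 + ‖θ 0 - θ'‖ ^ 2) / (2 * η * T) + η * L ^ 2 / 2
        = ((‖w 0 - w'‖ ^ 2 + ‖θ 0 - θ'‖ ^ 2) + T * (η ^ 2 * L ^ 2)) / (2 * η * T) := by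
      field_simp
    rw [e1, e2]
    gcongr
  rw [mul_sub] at hS2
  linarith
end

section
/- (Gap bound at the recursively regularized saddle point.) Let λ > 0, T a positive integer, and (w̄₀,θ̄₀), …, (w̄_{T−1},θ̄_{T−1}) ∈ W × Θ. Define F^{(T)}(w,θ) := F(w,θ) + λ·Σ_{t=0}^{T−1} 2^{t+1}·(‖w − w̄_t‖² − ‖θ − θ̄_t‖²). If (w*, θ*) ∈ W × Θ is a saddle point of F^{(T)} on W × Θ, i.e. F^{(T)}(w*, θ) ≤ F^{(T)}(w*, θ*) ≤ F^{(T)}(w, θ*) for all w ∈ W and θ ∈ Θ, then the gap of (w*,θ*) with respect to the unregularized F satisfies sup_{θ∈Θ} F(w*, θ) − inf_{w∈W} F(w, θ*) ≤ 2λB·Σ_{t=0}^{T−1} 2^{t+1}·‖(w*, θ*) − (w̄_t, θ̄_t)‖. -/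
theorem reg_aux_lim (a b k : ℝ) (hk : 0 ≤ k)
    (h : ∀ s : ℝ, 0 < s → s ≤ 1 → a ≤ b + s * k) : a ≤ b := by
  by_contra hab
  push Not at hab
  have he : 0 < a - b := by linarith
  have hd : 0 < 2 * (a - b + k) := by linarith
  have h1 := h ((a - b) / (2 * (a - b + k))) (by positivity)
    (by rw [div_le_one hd]; linarith)
  have h2 : (a - b) / (2 * (a - b + k)) * k ≤ (a - b) / 2 := by
    rw [div_mul_eq_mul_div, div_le_div_iff₀ hd (by norm_num)]
    nlinarith [mul_pos he he]
  linarith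

theorem reg_aux_min {E : Type*} [NormedAddCommGroup E] [InnerProductSpace ℝ E]
    (W : Set E) (f : E → ℝ) (hf : ConvexOn ℝ W f) (lam : ℝ) (hlam : 0 < lam) (T : ℕ)
    (c : ℕ → E) (x : E) (hx : x ∈ W)
    (hmin : ∀ y ∈ W, f x + lam * ∑ t ∈ Finset.range T, (2 : ℝ) ^ (t + 1) * ‖x - c t‖ ^ 2
      ≤ f y + lam * ∑ t ∈ Finset.range T, (2 : ℝ) ^ (t + 1) * ‖y - c t‖ ^ 2)
    (y : E) (hy : y ∈ W) :
    f x - f y ≤ 2 * lam * ∑ t ∈ Finset.range T, (2 : ℝ) ^ (t + 1) * inner ℝ (x - c t) (y - x) := by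
  apply reg_aux_lim _ _ (lam * ∑ t ∈ Finset.range T, (2 : ℝ) ^ (t + 1) * ‖y - x‖ ^ 2)
    (by positivity)
  intro s hs hs1
  have h1 := hf.2 hx hy (sub_nonneg.2 hs1) hs.le (by ring)
  have h2 := hmin _ (hf.1 hx hy (sub_nonneg.2 hs1) hs.le (by ring))
  have h3 : ∑ t ∈ Finset.range T, (2 : ℝ) ^ (t + 1) * ‖(1 - s) • x + s • y - c t‖ ^ 2
      = ∑ t ∈ Finset.range T, (2 : ℝ) ^ (t + 1) * ‖x - c t‖ ^ 2
        + 2 * s * ∑ t ∈ Finset.range T, (2 : ℝ) ^ (t + 1) * inner ℝ (x - c t) (y - x)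
        + s ^ 2 * ∑ t ∈ Finset.range T, (2 : ℝ) ^ (t + 1) * ‖y - x‖ ^ 2 := by
    rw [Finset.mul_sum, Finset.mul_sum, ← Finset.sum_add_distrib, ← Finset.sum_add_distrib]
    refine Finset.sum_congr rfl fun t _ => ?_
    have : (1 - s) • x + s • y - c t = (x - c t) + s • (y - x) := by module
    rw [this, norm_add_sq_real, norm_smul, inner_smul_right, mul_pow, Real.norm_eq_abs, sq_abs]
    ring
  rw [h3] at h2
  simp only [smul_eq_mul] at h1
  refine le_of_mul_le_mul_left ?_ hs
  linarith

/-- gap bound at the recursively regularized saddle point. If `(w*,θ*)`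
is a saddle point on `W × Θ` of
`F^{(T)}(w,θ) = F(w,θ) + λ·Σ_{t<T} 2^{t+1}(‖w − w̄_t‖² − ‖θ − θ̄_t‖²)`,
and the diameter of `W × Θ` is at most `B`, then the gap of `(w*,θ*)` with respect to
the unregularized `F` satisfies
`sup_{θ∈Θ} F(w*,θ) − inf_{w∈W} F(w,θ*) ≤ 2λB·Σ_{t<T} 2^{t+1}·‖(w*,θ*) − (w̄_t,θ̄_t)‖`. -/
theorem recursive_regularization_gap_bound {d₁ d₂ : ℕ}
    (W : Set (EuclideanSpace ℝ (Fin d₁))) (Θ : Set (EuclideanSpace ℝ (Fin d₂)))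
    (hWne : W.Nonempty) (hΘne : Θ.Nonempty)
    (hWcomp : IsCompact W) (hΘcomp : IsCompact Θ)
    (hWconv : Convex ℝ W) (hΘconv : Convex ℝ Θ)
    (B : ℝ)
    (hdiam : ∀ w₁ ∈ W, ∀ w₂ ∈ W, ∀ θ₁ ∈ Θ, ∀ θ₂ ∈ Θ,
      Real.sqrt (‖w₁ - w₂‖ ^ 2 + ‖θ₁ - θ₂‖ ^ 2) ≤ B)
    (F : EuclideanSpace ℝ (Fin d₁) → EuclideanSpace ℝ (Fin d₂) → ℝ)
    (hFdiff : Differentiable ℝ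
      (fun p : EuclideanSpace ℝ (Fin d₁) × EuclideanSpace ℝ (Fin d₂) => F p.1 p.2))
    (hconv : ∀ θ ∈ Θ, ConvexOn ℝ W (fun w => F w θ))
    (hconc : ∀ w ∈ W, ConcaveOn ℝ Θ (fun θ => F w θ))
    (lam : ℝ) (hlam : 0 < lam) (T : ℕ) (hT : 0 < T)
    (wbar : ℕ → EuclideanSpace ℝ (Fin d₁)) (θbar : ℕ → EuclideanSpace ℝ (Fin d₂))
    (hbarmem : ∀ t < T, wbar t ∈ W ∧ θbar t ∈ Θ)
    (wst : EuclideanSpace ℝ (Fin d₁)) (θst : EuclideanSpace ℝ (Fin d₂))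
    (hstmem : wst ∈ W ∧ θst ∈ Θ)
    (hsaddle :
      (let FT : EuclideanSpace ℝ (Fin d₁) → EuclideanSpace ℝ (Fin d₂) → ℝ := fun w θ =>
        F w θ + lam * ∑ t ∈ Finset.range T,
          (2 : ℝ) ^ (t + 1) * (‖w - wbar t‖ ^ 2 - ‖θ - θbar t‖ ^ 2)
       ∀ w ∈ W, ∀ θ ∈ Θ, FT wst θ ≤ FT wst θst ∧ FT wst θst ≤ FT w θst)) :
    sSup ((fun θ => F wst θ) '' Θ) - sInf ((fun w => F w θst) '' W)
      ≤ 2 * lam * B * ∑ t ∈ Finset.range T,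
          (2 : ℝ) ^ (t + 1) * Real.sqrt (‖wst - wbar t‖ ^ 2 + ‖θst - θbar t‖ ^ 2) := by
  obtain ⟨hw, hθ⟩ := hstmem
  simp only [mul_sub, Finset.sum_sub_distrib] at hsaddle
  have key1 := reg_aux_min W (fun w => F w θst) (hconv _ hθ) lam hlam T wbar wst hw
    (fun y hy => by have := (hsaddle y hy θst hθ).2; linarith)
  have key2 := reg_aux_min Θ (fun θ => - F wst θ) (hconc _ hw).neg lam hlam T θbar θst hθ
    (fun y hy => by have := (hsaddle wst hw y hy).1; linarith)
  rw [sub_le_iff_le_add]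
  refine csSup_le (hΘne.image _) ?_
  rintro _ ⟨θ, hθm, rfl⟩
  rw [← sub_le_iff_le_add']
  refine le_csInf (hWne.image _) ?_
  rintro _ ⟨w, hwm, rfl⟩
  have k1 := key1 w hwm
  have k2 := key2 θ hθm
  simp only at k1 k2 ⊢
  have hsum : ∑ t ∈ Finset.range T, (2 : ℝ) ^ (t + 1) * inner ℝ (wst - wbar t) (w - wst)
      + ∑ t ∈ Finset.range T, (2 : ℝ) ^ (t + 1) * inner ℝ (θst - θbar t) (θ - θst)
      ≤ B * ∑ t ∈ Finset.range T,
          (2 : ℝ) ^ (t + 1) * Real.sqrt (‖wst - wbar t‖ ^ 2 + ‖θst - θbar t‖ ^ 2) := by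
    rw [Finset.mul_sum, ← Finset.sum_add_distrib]
    refine Finset.sum_le_sum fun t _ => ?_
    have hB := hdiam w hwm wst hw θ hθm θst hθ
    have i1 := real_inner_le_norm (wst - wbar t) (w - wst)
    have i2 := real_inner_le_norm (θst - θbar t) (θ - θst)
    have cs : ‖wst - wbar t‖ * ‖w - wst‖ + ‖θst - θbar t‖ * ‖θ - θst‖
        ≤ Real.sqrt (‖w - wst‖ ^ 2 + ‖θ - θst‖ ^ 2)
          * Real.sqrt (‖wst - wbar t‖ ^ 2 + ‖θst - θbar t‖ ^ 2) := by
      rw [← Real.sqrt_mul (by positivity)]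
      apply Real.le_sqrt_of_sq_le
      nlinarith [sq_nonneg (‖wst - wbar t‖ * ‖θ - θst‖ - ‖θst - θbar t‖ * ‖w - wst‖)]
    have h4 := mul_le_mul_of_nonneg_right hB
      (Real.sqrt_nonneg (‖wst - wbar t‖ ^ 2 + ‖θst - θbar t‖ ^ 2))
    have h5 := mul_le_mul_of_nonneg_left (((add_le_add i1 i2).trans cs).trans h4)
      (show (0 : ℝ) ≤ 2 ^ (t + 1) by positivity)
    linarith
  have h6 := mul_le_mul_of_nonneg_left hsum (show 0 ≤ 2 * lam by positivity)
  linarith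
end

section
/- (Convergence of recursive regularization, deterministic form.) Let λ > 0, T a positive integer, and (w̄₀,θ̄₀), …, (w̄_{T−1},θ̄_{T−1}) ∈ W × Θ. Define recursively F^{(1)}(w,θ) := F(w,θ) + 2λ(‖w − w̄₀‖² − ‖θ − θ̄₀‖²) and F^{(t+1)}(w,θ) := F^{(t)}(w,θ) + 2^{t+1}λ(‖w − w̄_t‖² − ‖θ − θ̄_t‖²) for t = 1, …, T−1. For each t = 1, …, T let z*_t = (w*_t, θ*_t) ∈ W × Θ be a saddle point of F^{(t)} on W × Θ. Assume the distance conditions: ‖z*_{t+1} − (w̄_t, θ̄_t)‖ ≤ B/2^t for t = 0, …, T−1, and ‖(w̄_t, θ̄_t) − z*_t‖ ≤ B/2^t for t = 1, …, T−1. Then the final regularized saddle point has small gap with respect to the unregularized F: sup_{θ∈Θ} F(w*_T, θ) − inf_{w∈W} F(w, θ*_T) ≤ 12·T·λ·B². -/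
lemma rr_aux_lim (D a c : ℝ) (h : ∀ s : ℝ, 0 < s → s ≤ 1 → s * D ≤ s * a + s ^ 2 * c) :
    D ≤ a := by
  by_contra hlt
  push Not at hlt
  have h1 : ∀ s : ℝ, 0 < s → s ≤ 1 → D - a ≤ s * c := by
    intro s hs hs1
    have := h s hs hs1
    have h2 : s * (D - a) ≤ s * (s * c) := by nlinarith
    exact le_of_mul_le_mul_left h2 hs
  have hc : 0 < |c| + 1 := by positivity
  set s := min 1 ((D - a) / (2 * (|c| + 1))) with hs
  have hs0 : 0 < s := lt_min one_pos (div_pos (by linarith) (by positivity))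
  have h3 := h1 s hs0 (min_le_left _ _)
  have h4 : s * (2 * (|c| + 1)) ≤ D - a := by
    rw [← le_div_iff₀ (by positivity)]; exact min_le_right _ _
  have h5 : s * c ≤ s * |c| := mul_le_mul_of_nonneg_left (le_abs_self c) hs0.le
  nlinarith [abs_nonneg c, mul_nonneg hs0.le (abs_nonneg c)]

lemma rr_aux_opt {E : Type*} [NormedAddCommGroup E] [InnerProductSpace ℝ E]
    (S : Set E) (f : E → ℝ) (hf : ConvexOn ℝ S f) (lam : ℝ) (T : ℕ) (b : ℕ → E)
    (x y : E) (hx : x ∈ S) (hy : y ∈ S)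
    (hmin : ∀ w ∈ S, f x + lam * ∑ k ∈ Finset.range T, (2 : ℝ) ^ (k + 1) * ‖x - b k‖ ^ 2
      ≤ f w + lam * ∑ k ∈ Finset.range T, (2 : ℝ) ^ (k + 1) * ‖w - b k‖ ^ 2) :
    f x - f y ≤ lam * ∑ k ∈ Finset.range T, (2 : ℝ) ^ (k + 2) * inner ℝ (x - b k) (y - x) := by
  apply rr_aux_lim _ _ (lam * ∑ k ∈ Finset.range T, (2 : ℝ) ^ (k + 1) * ‖y - x‖ ^ 2)
  intro s hs hs1
  have hcv := hf.2 hx hy (sub_nonneg.2 hs1) hs.le (by ring)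
  have hmem := hf.1 hx hy (sub_nonneg.2 hs1) hs.le (by ring)
  have hm := hmin _ hmem
  have key : ∑ k ∈ Finset.range T, (2 : ℝ) ^ (k + 1) * ‖((1 - s) • x + s • y) - b k‖ ^ 2
      = ∑ k ∈ Finset.range T, (2 : ℝ) ^ (k + 1) * ‖x - b k‖ ^ 2
        + s * ∑ k ∈ Finset.range T, (2 : ℝ) ^ (k + 2) * inner ℝ (x - b k) (y - x)
        + s ^ 2 * ∑ k ∈ Finset.range T, (2 : ℝ) ^ (k + 1) * ‖y - x‖ ^ 2 := by
    rw [Finset.mul_sum, Finset.mul_sum, ← Finset.sum_add_distrib, ← Finset.sum_add_distrib]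
    refine Finset.sum_congr rfl fun k _ => ?_
    have : ((1 - s) • x + s • y) - b k = (x - b k) + s • (y - x) := by module
    rw [this, norm_add_sq_real, norm_smul, inner_smul_right, mul_pow, Real.norm_eq_abs, sq_abs]
    ring
  rw [key] at hm
  simp only [smul_eq_mul] at hcv
  nlinarith

lemma rr_aux_dist {E : Type*} [NormedAddCommGroup E] (B : ℝ) (T : ℕ)
    (p b : ℕ → E) (h1 : ∀ t < T, ‖p (t + 1) - b t‖ ≤ B / 2 ^ t)
    (h2 : ∀ t, 1 ≤ t → t ≤ T - 1 → ‖b t - p t‖ ≤ B / 2 ^ t) (k m : ℕ) (hk : k + 1 + m ≤ T) :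
    ‖p (k + 1 + m) - b k‖ ≤ B / 2 ^ k * (3 - 2 / 2 ^ m) := by
  induction m with
  | zero => have := h1 k (by omega); simp only [add_zero, pow_zero]; linarith
  | succ m ih =>
    have ih := ih (by omega)
    have a1 := h1 (k + 1 + m) (by omega)
    have a2 := h2 (k + 1 + m) (by omega) (by omega)
    have : p (k + 1 + (m + 1)) - b k = (p (k + 1 + m + 1) - b (k + 1 + m))
      + (b (k + 1 + m) - p (k + 1 + m)) + (p (k + 1 + m) - b k) := by
      rw [← add_assoc]; abel
    rw [this]
    refine (norm_add₃_le).trans ?_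
    have e : B / 2 ^ k * (3 - 2 / 2 ^ (m + 1)) =
      B / 2 ^ (k + 1 + m) + B / 2 ^ (k + 1 + m) + B / 2 ^ k * (3 - 2 / 2 ^ m) := by
      field_simp
      ring
    linarith

/-- convergence of recursive regularization (deterministic form).
With `F^{(t)}(w,θ) = F(w,θ) + λ·Σ_{k<t} 2^{k+1}(‖w − w̄_k‖² − ‖θ − θ̄_k‖²)`
(so `F^{(1)} = F + 2λ(‖w − w̄₀‖² − ‖θ − θ̄₀‖²)` and
`F^{(t+1)} = F^{(t)} + 2^{t+1}λ(‖w − w̄_t‖² − ‖θ − θ̄_t‖²)`), saddle points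
`z*_t = (w*_t, θ*_t)` of `F^{(t)}` for `t = 1,…,T`, diameter bound `B`, and the distance
conditions `‖z*_{t+1} − (w̄_t,θ̄_t)‖ ≤ B/2^t` (`t = 0,…,T−1`) and
`‖(w̄_t,θ̄_t) − z*_t‖ ≤ B/2^t` (`t = 1,…,T−1`), the final regularized saddle point has
gap at most `12·T·λ·B²` with respect to the unregularized `F`. -/
theorem recursive_regularization_convergence {d₁ d₂ : ℕ}
    (W : Set (EuclideanSpace ℝ (Fin d₁))) (Θ : Set (EuclideanSpace ℝ (Fin d₂)))
    (hWne : W.Nonempty) (hΘne : Θ.Nonempty)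
    (hWcomp : IsCompact W) (hΘcomp : IsCompact Θ)
    (hWconv : Convex ℝ W) (hΘconv : Convex ℝ Θ)
    (B : ℝ)
    (hdiam : ∀ w₁ ∈ W, ∀ w₂ ∈ W, ∀ θ₁ ∈ Θ, ∀ θ₂ ∈ Θ,
      Real.sqrt (‖w₁ - w₂‖ ^ 2 + ‖θ₁ - θ₂‖ ^ 2) ≤ B)
    (F : EuclideanSpace ℝ (Fin d₁) → EuclideanSpace ℝ (Fin d₂) → ℝ)
    (hFdiff : Differentiable ℝ
      (fun p : EuclideanSpace ℝ (Fin d₁) × EuclideanSpace ℝ (Fin d₂) => F p.1 p.2))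
    (hconv : ∀ θ ∈ Θ, ConvexOn ℝ W (fun w => F w θ))
    (hconc : ∀ w ∈ W, ConcaveOn ℝ Θ (fun θ => F w θ))
    (lam : ℝ) (hlam : 0 < lam) (T : ℕ) (hT : 0 < T)
    (wbar : ℕ → EuclideanSpace ℝ (Fin d₁)) (θbar : ℕ → EuclideanSpace ℝ (Fin d₂))
    (hbarmem : ∀ t < T, wbar t ∈ W ∧ θbar t ∈ Θ)
    (wst : ℕ → EuclideanSpace ℝ (Fin d₁)) (θst : ℕ → EuclideanSpace ℝ (Fin d₂))
    (hstmem : ∀ t, 1 ≤ t → t ≤ T → wst t ∈ W ∧ θst t ∈ Θ)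
    -- `z*_t = (w*_t, θ*_t)` is a saddle point of `F^{(t)}` on `W × Θ`, for `t = 1,…,T`
    (hsaddle :
      (let Ft : ℕ → EuclideanSpace ℝ (Fin d₁) → EuclideanSpace ℝ (Fin d₂) → ℝ :=
        fun t w θ => F w θ + lam * ∑ k ∈ Finset.range t,
          (2 : ℝ) ^ (k + 1) * (‖w - wbar k‖ ^ 2 - ‖θ - θbar k‖ ^ 2)
       ∀ t, 1 ≤ t → t ≤ T → ∀ w ∈ W, ∀ θ ∈ Θ,
         Ft t (wst t) θ ≤ Ft t (wst t) (θst t) ∧ Ft t (wst t) (θst t) ≤ Ft t w (θst t)))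
    -- distance conditions
    (hdist₁ : ∀ t < T,
      Real.sqrt (‖wst (t + 1) - wbar t‖ ^ 2 + ‖θst (t + 1) - θbar t‖ ^ 2) ≤ B / 2 ^ t)
    (hdist₂ : ∀ t, 1 ≤ t → t ≤ T - 1 →
      Real.sqrt (‖wbar t - wst t‖ ^ 2 + ‖θbar t - θst t‖ ^ 2) ≤ B / 2 ^ t) :
    sSup ((fun θ => F (wst T) θ) '' Θ) - sInf ((fun w => F w (θst T)) '' W)
      ≤ 12 * T * lam * B ^ 2 := by
  have hB : 0 ≤ B := by
    obtain ⟨w, hw⟩ := hWne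
    obtain ⟨θ, hθ⟩ := hΘne
    exact (Real.sqrt_nonneg _).trans (hdiam w hw w hw θ hθ θ hθ)
  obtain ⟨hwT, hθT⟩ := hstmem T hT le_rfl
  have main : ∀ w ∈ W, ∀ θ ∈ Θ, F (wst T) θ - F w (θst T) ≤ 12 * T * lam * B ^ 2 := by
    intro w hw θ hθ
    have hs := hsaddle T hT le_rfl
    simp only [mul_sub, Finset.sum_sub_distrib] at hs
    have o1 := rr_aux_opt W (fun w => F w (θst T)) (hconv _ hθT) lam T wbar (wst T) w hwT hw
      (by intro v hv; have := (hs v hv θ hθ).2; linarith)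
    have o2 := rr_aux_opt Θ (fun θ => - F (wst T) θ) (hconc _ hwT).neg lam T θbar (θst T) θ hθT hθ
      (by intro v hv; have := (hs w hw v hv).1; linarith)
    let p : ℕ → WithLp 2 (EuclideanSpace ℝ (Fin d₁) × EuclideanSpace ℝ (Fin d₂)) :=
      fun t => WithLp.toLp 2 (wst t, θst t)
    let b : ℕ → WithLp 2 (EuclideanSpace ℝ (Fin d₁) × EuclideanSpace ℝ (Fin d₂)) :=
      fun t => WithLp.toLp 2 (wbar t, θbar t)
    let z : WithLp 2 (EuclideanSpace ℝ (Fin d₁) × EuclideanSpace ℝ (Fin d₂)) :=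
      WithLp.toLp 2 (w, θ)
    have hz : ‖z - p T‖ ≤ B := by
      rw [WithLp.prod_norm_eq_of_L2]
      exact hdiam w hw _ hwT θ hθ _ hθT
    have hd : ∀ k < T, ‖p T - b k‖ ≤ 3 * (B / 2 ^ k) := by
      intro k hk
      obtain ⟨m, rfl⟩ : ∃ m, T = k + 1 + m := ⟨T - (k + 1), by omega⟩
      have := rr_aux_dist B (k + 1 + m) p b
        (fun t ht => by rw [WithLp.prod_norm_eq_of_L2]; exact hdist₁ t ht)
        (fun t ht ht' => by rw [WithLp.prod_norm_eq_of_L2]; exact hdist₂ t ht ht') k m le_rfl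
      refine this.trans ?_
      have h1 : 0 ≤ B / 2 ^ k := by positivity
      have h2 : (0 : ℝ) ≤ 2 / 2 ^ m := by positivity
      nlinarith [mul_nonneg h1 h2]
    have hsum : ∑ k ∈ Finset.range T, (2 : ℝ) ^ (k + 2) * inner ℝ (wst T - wbar k) (w - wst T)
        + ∑ k ∈ Finset.range T, (2 : ℝ) ^ (k + 2) * inner ℝ (θst T - θbar k) (θ - θst T)
        ≤ ∑ k ∈ Finset.range T, 12 * B ^ 2 := by
      rw [← Finset.sum_add_distrib]
      refine Finset.sum_le_sum fun k hk => ?_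
      have hk := hd k (Finset.mem_range.1 hk)
      have hi : inner ℝ (wst T - wbar k) (w - wst T) + inner ℝ (θst T - θbar k) (θ - θst T)
        = inner ℝ (p T - b k) (z - p T) := by
        rw [WithLp.prod_inner_apply]; rfl
      rw [← mul_add, hi]
      calc (2 : ℝ) ^ (k + 2) * inner ℝ (p T - b k) (z - p T)
          ≤ 2 ^ (k + 2) * (3 * (B / 2 ^ k) * B) := by
            gcongr
            exact (real_inner_le_norm _ _).trans
              (mul_le_mul hk hz (norm_nonneg _) (by positivity))
        _ = 12 * B ^ 2 := by field_simp; ring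
    rw [Finset.sum_const, Finset.card_range, nsmul_eq_mul] at hsum
    have := mul_le_mul_of_nonneg_left hsum hlam.le
    linarith
  have h1 : ∀ w ∈ W, sSup ((fun θ => F (wst T) θ) '' Θ) ≤ 12 * T * lam * B ^ 2 + F w (θst T) := by
    intro w hw
    refine csSup_le (hΘne.image _) ?_
    rintro _ ⟨θ, hθ, rfl⟩
    have := main w hw θ hθ
    simp only
    linarith
  have h2 : sSup ((fun θ => F (wst T) θ) '' Θ) - 12 * T * lam * B ^ 2
      ≤ sInf ((fun w => F w (θst T)) '' W) := by
    refine le_csInf (hWne.image _) ?_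
    rintro _ ⟨w, hw, rfl⟩
    have := h1 w hw
    simp only
    linarith
  linarith
end
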